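/- arXiv:2412.01884 — 4 statements merged into one kernel-verified Lean document; each statement's English description precedes it below -/
import Mathlib

section
/- Let n ≥ 1 be an integer and let G be a real antisymmetric 2n×2n matrix (Gᵀ = −G) with operator norm at most 1. Then for every m ∈ {0,1}^n, det(1 − κ_m G) ≥ 0, and the Born probabilities p_m = 2^{−n} √(det(1 − κ_m G)) sum to one: Σ_{m ∈ {0,1}^n} 2^{−n} √(det(1 − κ_m G)) = 1. -/
open Matrix

noncomputable section

/-- The block-diagonal matrix `⊕_{i=1}^{n} [[0,1],[-1,0]]`. -/
def Jmat (n : ℕ) : Matrix (Fin (2 * n)) (Fin (2 * n)) ℝ :=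
  Matrix.of fun i j =>
    if i.val % 2 = 0 ∧ j.val = i.val + 1 then (1 : ℝ)
    else if j.val % 2 = 0 ∧ i.val = j.val + 1 then -1 else 0

/-- The matrix `κ_m = ⊕_{i=1}^{n} (-1)^{m_i} [[0,1],[-1,0]]` for an outcome `m ∈ {0,1}^n`. -/
def kappaM (n : ℕ) (m : Fin n → Bool) : Matrix (Fin (2 * n)) (Fin (2 * n)) ℝ :=
  Matrix.of fun i j =>
    (if m ⟨i.val / 2, by have := i.isLt; omega⟩ then -1 else 1) * Jmat n i j

/-- The elementary symplectic block `[[0,1],[-1,0]]`. -/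
def symplecticBlock : Matrix (Fin 2) (Fin 2) ℝ := !![0, 1; -1, 0]

/-- Splits off the last two of `2 * (n + 1)` indices. -/
def splitLastPair (n : ℕ) : Fin (2 * n) ⊕ Fin 2 ≃ Fin (2 * (n + 1)) :=
  finSumFinEquiv (m := 2 * n) (n := 2)

/-- The sign `(-1)^b`. -/
def boolSign (b : Bool) : ℝ := if b then -1 else 1

lemma boolSign_mul_self (b : Bool) : boolSign b * boolSign b = 1 := by
  cases b <;> simp [boolSign]

lemma splitLastPair_inl_val (n : ℕ) (i : Fin (2 * n)) :
    (splitLastPair n (Sum.inl i)).val = i.val := rfl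

lemma splitLastPair_inr_val (n : ℕ) (i : Fin 2) :
    (splitLastPair n (Sum.inr i)).val = 2 * n + i.val := rfl

lemma kappaM_snoc_submatrix (n : ℕ) (m : Fin n → Bool) (b : Bool) :
    (kappaM (n + 1) (Fin.snoc (α := fun _ => Bool) m b)).submatrix
        (splitLastPair n) (splitLastPair n) =
      fromBlocks (kappaM n m) 0 0 (boolSign b • symplecticBlock) := by
  ext (i | i) (j | j)
  · have h : i.val / 2 < n := by omega
    simp [kappaM, Jmat, splitLastPair_inl_val, Fin.snoc, h]
  · have h : i.val / 2 < n := by omega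
    have h1 : ¬ (i.val % 2 = 0 ∧ 2 * n + j.val = i.val + 1) := by omega
    have h2 : ¬ (j.val % 2 = 0 ∧ i.val = 2 * n + j.val + 1) := by omega
    simp [kappaM, Jmat, splitLastPair_inl_val, splitLastPair_inr_val, h1, h2]
  · have h1 : ¬ (i.val % 2 = 0 ∧ j.val = 2 * n + i.val + 1) := by omega
    have h2 : ¬ (j.val % 2 = 0 ∧ 2 * n + i.val = j.val + 1) := by omega
    simp [kappaM, Jmat, splitLastPair_inl_val, splitLastPair_inr_val, h1, h2]
  · have h : ¬ ((2 * n + 1) / 2 < n) := by omega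
    simp only [kappaM, Jmat, splitLastPair_inr_val, Fin.snoc, boolSign, symplecticBlock,
      submatrix_apply, of_apply, fromBlocks_apply₂₂, Matrix.smul_apply]
    fin_cases i <;> fin_cases j <;> simp [h]

lemma forall_snoc {n : ℕ} {P : (Fin (n + 1) → Bool) → Prop}
    (h : ∀ (m : Fin n → Bool) (b : Bool), P (Fin.snoc (α := fun _ => Bool) m b)) (m) : P m := by
  have := h (Fin.init m) (m (Fin.last n))
  rwa [Fin.snoc_init_self] at this

lemma symplecticBlock_mul_self : symplecticBlock * symplecticBlock = -1 := by
  ext i j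
  fin_cases i <;> fin_cases j <;> simp [symplecticBlock]

lemma symplecticBlock_transpose : symplecticBlockᵀ = -symplecticBlock := by
  ext i j
  fin_cases i <;> fin_cases j <;> simp [symplecticBlock]

lemma kappaM_transpose (n : ℕ) (m : Fin n → Bool) : (kappaM n m)ᵀ = -kappaM n m := by
  induction n with
  | zero => ext i; exact i.elim0
  | succ n ih =>
    induction m using forall_snoc with
    | h m b =>
      apply (Matrix.reindex (splitLastPair n).symm (splitLastPair n).symm).injective
      simp only [reindex_apply, Equiv.symm_symm, submatrix_neg, Pi.neg_apply, ← transpose_submatrix,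
        kappaM_snoc_submatrix, fromBlocks_transpose, fromBlocks_neg, ih, transpose_smul,
        symplecticBlock_transpose]
      simp

lemma kappaM_mul_self (n : ℕ) (m : Fin n → Bool) : kappaM n m * kappaM n m = -1 := by
  induction n with
  | zero => ext i; exact i.elim0
  | succ n ih =>
    induction m using forall_snoc with
    | h m b =>
      apply (Matrix.reindex (splitLastPair n).symm (splitLastPair n).symm).injective
      simp only [reindex_apply, Equiv.symm_symm, submatrix_neg, Pi.neg_apply,
        ← submatrix_mul_equiv _ _ _ (splitLastPair n) _,
        kappaM_snoc_submatrix, fromBlocks_multiply, ih, submatrix_one_equiv]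
      rw [← fromBlocks_one, fromBlocks_neg]
      simp [symplecticBlock_mul_self, smul_smul, boolSign_mul_self]

lemma sum_sq_mulVec_of_skew_of_mul_self {ι : Type*} [Fintype ι] [DecidableEq ι]
    {K : Matrix ι ι ℝ} (hT : Kᵀ = -K) (hK : K * K = -1) (v : ι → ℝ) :
    ∑ i, (K *ᵥ v) i ^ 2 = ∑ i, v i ^ 2 := by
  have h : (K *ᵥ v) ⬝ᵥ (K *ᵥ v) = v ⬝ᵥ v := by
    rw [dotProduct_mulVec, vecMul_mulVec, hT, neg_mul, hK]
    simp
  simpa [dotProduct, pow_two] using h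

/-- A linear map that does not decrease the norm stays injective after adding a strict
contraction. -/
lemma det_add_ne_zero {ι : Type*} [Fintype ι] [DecidableEq ι] {S G : Matrix ι ι ℝ}
    (hS : ∀ v, ∑ i, v i ^ 2 ≤ ∑ i, (S *ᵥ v) i ^ 2)
    (hG : ∀ v, v ≠ 0 → ∑ i, (G *ᵥ v) i ^ 2 < ∑ i, v i ^ 2) : (S + G).det ≠ 0 := by
  intro h
  obtain ⟨v, hv, h0⟩ := exists_mulVec_eq_zero_iff.mpr h
  rw [add_mulVec] at h0
  have h1 : S *ᵥ v = -(G *ᵥ v) := eq_neg_of_add_eq_zero_left h0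
  have h2 := hS v
  rw [h1] at h2
  simp only [Pi.neg_apply, neg_sq] at h2
  exact absurd (hG v hv) (not_lt.mpr h2)

lemma skew_two_eq_smul {X : Matrix (Fin 2) (Fin 2) ℝ} (hX : Xᵀ = -X) :
    X = X 0 1 • symplecticBlock := by
  have h (i j) : X j i = -X i j := congrFun (congrFun hX i) j
  ext i j
  fin_cases i <;> fin_cases j <;> simp [symplecticBlock]
  · linarith [h 0 0]
  · exact h 0 1
  · linarith [h 1 1]

/-- Appending a `2 × 2` block to a skew-symmetric matrix multiplies the determinant by the square
of an affine function of the coefficient of the new block. -/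
lemma exists_det_fromBlocks_skew {ι : Type*} [Fintype ι] [DecidableEq ι]
    {K A : Matrix ι ι ℝ} {B : Matrix ι (Fin 2) ℝ} {C : Matrix (Fin 2) ι ℝ}
    {D : Matrix (Fin 2) (Fin 2) ℝ} (hK : Kᵀ = -K)
    (hG : (fromBlocks A B C D)ᵀ = -fromBlocks A B C D) (hdet : (K + A).det ≠ 0) :
    ∃ c : ℝ, ∀ t : ℝ,
      (fromBlocks K 0 0 (t • symplecticBlock) + fromBlocks A B C D).det =
        (K + A).det * (t + c) ^ 2 := by
  rw [fromBlocks_transpose, fromBlocks_neg, fromBlocks_inj] at hG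
  obtain ⟨hA, hC, hB, hD⟩ := hG
  let _ : Invertible (K + A) := invertibleOfIsUnitDet _ (isUnit_iff_ne_zero.mpr hdet)
  have hX : (D - C * ⅟(K + A) * B)ᵀ = -(D - C * ⅟(K + A) * B) := by
    have hinv : (⅟(K + A))ᵀ = -⅟(K + A) := by
      rw [invOf_eq_nonsing_inv, transpose_nonsing_inv, transpose_add, hK, hA, ← neg_add]
      exact inv_eq_left_inv (by rw [neg_mul_neg, nonsing_inv_mul _ (isUnit_iff_ne_zero.mpr hdet)])
    rw [transpose_sub, transpose_mul, transpose_mul, hinv, hB, hC, hD]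
    simp [Matrix.mul_assoc, add_comm, sub_eq_add_neg]
  refine ⟨(D - C * ⅟(K + A) * B) 0 1, fun t => ?_⟩
  rw [fromBlocks_add, zero_add, zero_add, det_fromBlocks₁₁, add_sub_assoc]
  nth_rewrite 1 [skew_two_eq_smul hX]
  rw [← add_smul, det_smul]
  simp [symplecticBlock]

lemma sum_sq_fromBlocks_mulVec {ι : Type*} [Fintype ι] [DecidableEq ι]
    {K : Matrix ι ι ℝ} (hT : Kᵀ = -K) (hK : K * K = -1) {t : ℝ} (ht : 1 ≤ t ^ 2)
    (v : ι ⊕ Fin 2 → ℝ) :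
    ∑ i, v i ^ 2 ≤ ∑ i, (fromBlocks K 0 0 (t • symplecticBlock) *ᵥ v) i ^ 2 := by
  have h1 := sum_sq_mulVec_of_skew_of_mul_self hT hK (v ∘ Sum.inl)
  have h2 := sum_sq_mulVec_of_skew_of_mul_self symplecticBlock_transpose
    symplecticBlock_mul_self (v ∘ Sum.inr)
  rw [fromBlocks_mulVec]
  simp only [Fintype.sum_sum_type, Sum.elim_inl, Sum.elim_inr, zero_mulVec, add_zero, zero_add,
    smul_mulVec, Pi.smul_apply, smul_eq_mul, mul_pow, ← Finset.mul_sum, h1, h2]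
  simp only [Function.comp_apply]
  gcongr
  exact le_mul_of_one_le_left (by positivity) ht

lemma strictContraction_toBlocks₁₁ {ι κ : Type*} [Fintype ι] [Fintype κ]
    {A : Matrix ι ι ℝ} {B : Matrix ι κ ℝ} {C : Matrix κ ι ℝ} {D : Matrix κ κ ℝ}
    (hG : ∀ v, v ≠ 0 → ∑ i, (fromBlocks A B C D *ᵥ v) i ^ 2 < ∑ i, v i ^ 2)
    (v : ι → ℝ) (hv : v ≠ 0) : ∑ i, (A *ᵥ v) i ^ 2 < ∑ i, v i ^ 2 := by
  have hne : Sum.elim v (0 : κ → ℝ) ≠ 0 := fun h => hv (funext fun i => congrFun h (Sum.inl i))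
  have h := hG _ hne
  rw [fromBlocks_mulVec] at h
  simp only [Fintype.sum_sum_type, Sum.elim_inl, Sum.elim_inr, Sum.elim_comp_inl,
    Sum.elim_comp_inr, mulVec_zero, add_zero, Pi.zero_apply, ne_eq, OfNat.ofNat_ne_zero,
    not_false_eq_true, zero_pow, Finset.sum_const_zero] at h
  exact lt_of_le_of_lt (le_add_of_nonneg_right (by positivity)) h

lemma strictContraction_submatrix {ι κ : Type*} [Fintype ι] [Fintype κ] {G : Matrix ι ι ℝ}
    (hG : ∀ v, v ≠ 0 → ∑ i, (G *ᵥ v) i ^ 2 < ∑ i, v i ^ 2) (e : κ ≃ ι)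
    (v : κ → ℝ) (hv : v ≠ 0) : ∑ i, (G.submatrix e e *ᵥ v) i ^ 2 < ∑ i, v i ^ 2 := by
  have hne : v ∘ e.symm ≠ 0 := fun h => hv (funext fun i => by simpa using congrFun h (e i))
  have h := hG _ hne
  rw [submatrix_mulVec_equiv, ← e.sum_comp (fun i => (v ∘ e.symm) i ^ 2),
    ← e.sum_comp (fun i => (G *ᵥ (v ∘ e.symm)) i ^ 2)] at *
  simpa using h

lemma sum_snoc {n : ℕ} (f : (Fin (n + 1) → Bool) → ℝ) :
    ∑ m, f m = ∑ m : Fin n → Bool, (f (Fin.snoc (α := fun _ => Bool) m true) +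
      f (Fin.snoc (α := fun _ => Bool) m false)) := by
  rw [← (Fin.snocEquiv (fun _ : Fin (n + 1) => Bool)).sum_comp, Fintype.sum_prod_type_right]
  simp [Fin.snocEquiv]

theorem det_kappaM_add_pos_and_sum (n : ℕ) (G : Matrix (Fin (2 * n)) (Fin (2 * n)) ℝ)
    (hanti : Gᵀ = -G) (hG : ∀ v, v ≠ 0 → ∑ i, (G *ᵥ v) i ^ 2 < ∑ i, v i ^ 2) :
    (∀ m, 0 < (kappaM n m + G).det) ∧ ∑ m, √((kappaM n m + G).det) = 2 ^ n := by
  induction n with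
  | zero => constructor <;> simp
  | succ n ih =>
    obtain ⟨A, B, C, D, hblock⟩ : ∃ A B C D,
        G.submatrix (splitLastPair n) (splitLastPair n) = fromBlocks A B C D :=
      ⟨_, _, _, _, (fromBlocks_toBlocks _).symm⟩
    have hskew : (fromBlocks A B C D)ᵀ = -fromBlocks A B C D := by
      rw [← hblock, transpose_submatrix, hanti]
      rfl
    have hstrict : ∀ v, v ≠ 0 → ∑ i, (fromBlocks A B C D *ᵥ v) i ^ 2 < ∑ i, v i ^ 2 := by
      rw [← hblock]
      exact strictContraction_submatrix hG _
    have hA : Aᵀ = -A := by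
      rw [fromBlocks_transpose, fromBlocks_neg, fromBlocks_inj] at hskew
      exact hskew.1
    obtain ⟨hpos, hsum⟩ := ih A hA (strictContraction_toBlocks₁₁ hstrict)
    have key (m : Fin n → Bool) : ∃ c : ℝ, |c| < 1 ∧ ∀ b,
        (kappaM (n + 1) (Fin.snoc (α := fun _ => Bool) m b) + G).det =
          (kappaM n m + A).det * (boolSign b + c) ^ 2 := by
      obtain ⟨c, hc⟩ := exists_det_fromBlocks_skew (kappaM_transpose n m) hskew (hpos m).ne'
      refine ⟨c, ?_, fun b => ?_⟩
      · by_contra! hle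
        have ht : 1 ≤ (-c) ^ 2 := by rw [neg_sq, ← sq_abs]; exact one_le_pow₀ hle
        apply det_add_ne_zero (sum_sq_fromBlocks_mulVec (kappaM_transpose n m)
          (kappaM_mul_self n m) ht) hstrict
        rw [hc]
        simp
      · rw [← hc, ← hblock, ← kappaM_snoc_submatrix]
        exact (det_submatrix_equiv_self (splitLastPair n) _).symm
    constructor
    · refine forall_snoc fun m b => ?_
      obtain ⟨c, hc, h⟩ := key m
      rw [h]
      obtain ⟨h1, h2⟩ := abs_lt.mp hc
      refine mul_pos (hpos m) (sq_pos_of_ne_zero ?_)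
      cases b <;> simp only [boolSign] <;> norm_num <;> intro h0 <;> linarith
    · rw [sum_snoc, pow_succ, ← hsum, Finset.sum_mul]
      refine Finset.sum_congr rfl fun m _ => ?_
      obtain ⟨c, hc, h⟩ := key m
      obtain ⟨h1, h2⟩ := abs_lt.mp hc
      rw [h, h, Real.sqrt_mul (hpos m).le, Real.sqrt_mul (hpos m).le, Real.sqrt_sq_eq_abs,
        Real.sqrt_sq_eq_abs, ← mul_add]
      congr 1
      simp only [boolSign, if_true, Bool.false_eq_true, if_false]
      rw [abs_of_neg (by linarith), abs_of_pos (by linarith)]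
      ring

lemma det_kappaM (n : ℕ) (m : Fin n → Bool) : (kappaM n m).det = 1 := by
  have hpos := (det_kappaM_add_pos_and_sum n 0 (by simp) fun v hv => by
    obtain ⟨i, hi⟩ := Function.ne_iff.mp hv
    simpa using Finset.sum_pos' (fun i _ => sq_nonneg (v i))
      ⟨i, Finset.mem_univ i, sq_pos_of_ne_zero hi⟩).1 m
  have hsq : (kappaM n m).det * (kappaM n m).det = 1 := by
    rw [← det_mul, kappaM_mul_self, det_neg]
    simp
  rw [add_zero] at hpos
  nlinarith

lemma det_one_sub_kappaM_mul (n : ℕ) (m : Fin n → Bool)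
    (G : Matrix (Fin (2 * n)) (Fin (2 * n)) ℝ) :
    (1 - kappaM n m * G).det = (kappaM n m + G).det := by
  have h : 1 - kappaM n m * G = -(kappaM n m * (kappaM n m + G)) := by
    rw [mul_add, kappaM_mul_self]
    abel
  rw [h, det_neg, det_mul, det_kappaM]
  simp

lemma strictContraction_smul {ι : Type*} [Fintype ι] {G : Matrix ι ι ℝ}
    (hG : ∀ v : ι → ℝ, ∑ i, (G *ᵥ v) i ^ 2 ≤ ∑ i, v i ^ 2) {s : ℝ} (hs : s ∈ Set.Ico (0 : ℝ) 1)
    (v : ι → ℝ) (hv : v ≠ 0) : ∑ i, ((s • G) *ᵥ v) i ^ 2 < ∑ i, v i ^ 2 := by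
  obtain ⟨i, hi⟩ := Function.ne_iff.mp hv
  have hpos : 0 < ∑ i, v i ^ 2 := Finset.sum_pos' (fun i _ => sq_nonneg (v i))
    ⟨i, Finset.mem_univ i, sq_pos_of_ne_zero hi⟩
  simp only [smul_mulVec, Pi.smul_apply, smul_eq_mul, mul_pow, ← Finset.mul_sum]
  calc s ^ 2 * ∑ i, (G *ᵥ v) i ^ 2 ≤ s ^ 2 * ∑ i, v i ^ 2 := mul_le_mul_of_nonneg_left (hG v) (sq_nonneg s)
    _ < ∑ i, v i ^ 2 := mul_lt_of_lt_one_left hpos (pow_lt_one₀ hs.1 hs.2 two_ne_zero)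

/-- For a real antisymmetric `2n×2n` matrix `G` of operator norm at most
one, the determinants `det(1 - κ_m G)` are nonnegative and the Born probabilities
`p_m = 2^{-n} √(det(1 - κ_m G))` sum to one. -/
theorem born_probabilities_sum_to_one
    (n : ℕ) (hn : 1 ≤ n)
    (G : Matrix (Fin (2 * n)) (Fin (2 * n)) ℝ)
    (hanti : Gᵀ = -G)
    (hop : ∀ v : Fin (2 * n) → ℝ, ∑ i, (G.mulVec v i) ^ 2 ≤ ∑ i, (v i) ^ 2) :
    (∀ m : Fin n → Bool, 0 ≤ ((1 : Matrix (Fin (2 * n)) (Fin (2 * n)) ℝ) - kappaM n m * G).det) ∧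
      ∑ m : Fin n → Bool,
        (1 / 2 : ℝ) ^ n *
          Real.sqrt (((1 : Matrix (Fin (2 * n)) (Fin (2 * n)) ℝ) - kappaM n m * G).det) = 1 := by
  have hmem : (1 : ℝ) ∈ closure (Set.Ico (0 : ℝ) 1) := by
    rw [closure_Ico zero_ne_one]
    exact ⟨zero_le_one, le_rfl⟩
  have hstrict (s : ℝ) (hs : s ∈ Set.Ico (0 : ℝ) 1) :=
    det_kappaM_add_pos_and_sum n (s • G) (by rw [transpose_smul, hanti, smul_neg])
      (strictContraction_smul hop hs)
  have hcont (m : Fin n → Bool) : Continuous fun s : ℝ => (kappaM n m + s • G).det := by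
    fun_prop
  simp only [det_one_sub_kappaM_mul, ← Finset.mul_sum]
  constructor
  · intro m
    have hclosed : IsClosed {s : ℝ | 0 ≤ (kappaM n m + s • G).det} :=
      isClosed_le continuous_const (hcont m)
    simpa using hclosed.closure_subset_iff.mpr (fun s hs => ((hstrict s hs).1 m).le) hmem
  · have hclosed : IsClosed {s : ℝ | ∑ m, √((kappaM n m + s • G).det) = 2 ^ n} :=
      isClosed_eq (continuous_finsetSum _ fun m _ => (hcont m).sqrt) continuous_const
    have h := hclosed.closure_subset_iff.mpr (fun s hs => (hstrict s hs).2) hmem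
    simp only [Set.mem_ofPred_eq, one_smul] at h
    rw [h, ← mul_pow]
    norm_num
end
end

section
/- Let f : [−1,1] → ℝ be a 1-Lipschitz function and let k ≥ 1 be an integer. Then there exist real coefficients a_0, a_1, ..., a_k with |a_r| ≤ 2/r for every 1 ≤ r ≤ k, such that the polynomial f_k(θ) = Σ_{r=0}^{k} a_r T_r(θ) satisfies sup_{θ ∈ [−1,1]} |f(θ) − f_k(θ)| ≤ 6/k. -/
open Polynomial

namespace LipschitzChebyshev

open Real Finset intervalIntegral

/-- The squared modulus of the trigonometric polynomial `∑ j < n, c j * exp (i j u)`. -/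
noncomputable def sqKernel (c : ℕ → ℝ) (n : ℕ) (u : ℝ) : ℝ :=
  ∑ i ∈ range n, ∑ j ∈ range n, c i * c j * cos (((i : ℤ) - (j : ℤ) : ℤ) * u)

lemma sqKernel_nonneg (c : ℕ → ℝ) (n : ℕ) (u : ℝ) : 0 ≤ sqKernel c n u := by
  have h : sqKernel c n u =
      (∑ i ∈ range n, c i * cos (i * u)) ^ 2 + (∑ i ∈ range n, c i * sin (i * u)) ^ 2 := by
    rw [sq, sq, sum_mul_sum, sum_mul_sum, ← sum_add_distrib, sqKernel]
    refine sum_congr rfl fun i _ => ?_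
    rw [← sum_add_distrib]
    refine sum_congr rfl fun j _ => ?_
    push_cast
    rw [sub_mul, cos_sub]
    ring
  rw [h]
  positivity

lemma continuous_sqKernel (c : ℕ → ℝ) (n : ℕ) : Continuous (sqKernel c n) := by
  unfold sqKernel
  fun_prop

lemma sqKernel_periodic (c : ℕ → ℝ) (n : ℕ) : Function.Periodic (sqKernel c n) (2 * π) := by
  intro u
  unfold sqKernel
  refine sum_congr rfl fun i _ => sum_congr rfl fun j _ => ?_
  rw [mul_add, cos_add_int_mul_two_pi]

lemma integral_cos_int_mul (m : ℤ) :
    ∫ t in (0 : ℝ)..2 * π, cos (m * t) = if m = 0 then 2 * π else 0 := by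
  split_ifs with h
  · simp [h]
  · have h' : (m : ℝ) ≠ 0 := by exact_mod_cast h
    rw [integral_comp_mul_left (fun x => cos x) h', integral_cos]
    have : sin (m * (2 * π)) = 0 := by
      have := sin_add_int_mul_two_pi 0 m
      simpa using this
    simp [this]

lemma integral_sqKernel (c : ℕ → ℝ) (n : ℕ) :
    ∫ t in (0 : ℝ)..2 * π, sqKernel c n t = 2 * π * ∑ i ∈ range n, c i ^ 2 := by
  unfold sqKernel
  rw [integral_finsetSum (fun i _ => Continuous.intervalIntegrable (by fun_prop) _ _), mul_sum]
  refine sum_congr rfl fun i hi => ?_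
  rw [integral_finsetSum (fun i _ => Continuous.intervalIntegrable (by fun_prop) _ _)]
  simp_rw [integral_const_mul, integral_cos_int_mul]
  rw [sum_eq_single i]
  · simp; ring
  · intro j _ hj
    rw [if_neg (by omega), mul_zero]
  · exact fun h => absurd hi h

lemma integral_sqKernel_mul_cos (c : ℕ → ℝ) (n : ℕ) :
    ∫ t in (0 : ℝ)..2 * π, sqKernel c n t * cos t =
      π * ∑ i ∈ range n, c i * ((∑ j ∈ range n, if j = i + 1 then c j else 0) +
        ∑ j ∈ range n, if i = j + 1 then c j else 0) := by
  have h : ∀ t, sqKernel c n t * cos t = ∑ i ∈ range n, ∑ j ∈ range n, c i * c j / 2 *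
      (cos (((i : ℤ) - j + 1 : ℤ) * t) + cos (((i : ℤ) - j - 1 : ℤ) * t)) := by
    intro t
    unfold sqKernel
    simp_rw [sum_mul]
    refine sum_congr rfl fun i _ => sum_congr rfl fun j _ => ?_
    push_cast
    rw [add_mul ((i : ℝ) - j), sub_mul ((i : ℝ) - j), cos_add, cos_sub, one_mul]
    ring
  simp_rw [h]
  rw [integral_finsetSum (fun i _ => Continuous.intervalIntegrable (by fun_prop) _ _), mul_sum]
  refine sum_congr rfl fun i hi => ?_
  rw [integral_finsetSum (fun i _ => Continuous.intervalIntegrable (by fun_prop) _ _),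
    ← sum_add_distrib, mul_sum, mul_sum]
  refine sum_congr rfl fun j _ => ?_
  rw [integral_const_mul, integral_add (Continuous.intervalIntegrable (by fun_prop) _ _)
    (Continuous.intervalIntegrable (by fun_prop) _ _), integral_cos_int_mul, integral_cos_int_mul]
  have h1 : ((i : ℤ) - j + 1 = 0) ↔ j = i + 1 := by omega
  have h2 : ((i : ℤ) - j - 1 = 0) ↔ i = j + 1 := by omega
  simp only [h1, h2]
  split_ifs <;> first | omega | ring

/-- The sine weights for which the kernel has the largest possible first Fourier coefficient. -/
noncomputable def sineWeight (k i : ℕ) : ℝ := sin ((i + 1) * (π / (k + 2)))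

lemma sineWeight_neighbours (k i : ℕ) (hi : i ∈ range (k + 1)) :
    ((∑ j ∈ range (k + 1), if j = i + 1 then sineWeight k j else 0) +
        ∑ j ∈ range (k + 1), if i = j + 1 then sineWeight k j else 0) =
      2 * cos (π / (k + 2)) * sineWeight k i := by
  have hi' : i < k + 1 := mem_range.1 hi
  have h1 : (∑ j ∈ range (k + 1), if j = i + 1 then sineWeight k j else 0) =
      sin ((i + 1) * (π / (k + 2)) + π / (k + 2)) := by
    rw [sum_ite_eq']
    split_ifs with h
    · unfold sineWeight
      push_cast
      congr 1
      ring
    · have : i = k := by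
        rw [mem_range] at h
        omega
      subst this
      have : ((i : ℝ) + 1) * (π / (i + 2)) + π / (i + 2) = π := by
        field_simp
        ring
      rw [this, sin_pi]
  have h2 : (∑ j ∈ range (k + 1), if i = j + 1 then sineWeight k j else 0) =
      sin ((i + 1) * (π / (k + 2)) - π / (k + 2)) := by
    cases i with
    | zero => simp
    | succ m =>
      simp only [Nat.add_right_cancel_iff]
      rw [sum_ite_eq, if_pos (mem_range.2 (by omega))]
      unfold sineWeight
      push_cast
      congr 1
      ring
  rw [h1, h2, sin_add, sin_sub, sineWeight]
  ring

lemma sum_sq_sineWeight_pos (k : ℕ) : 0 < ∑ i ∈ range (k + 1), sineWeight k i ^ 2 := by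
  refine sum_pos' (fun i _ => sq_nonneg _) ⟨0, by simp, ?_⟩
  have : 0 < sineWeight k 0 := by
    unfold sineWeight
    have hk : (0 : ℝ) ≤ k := k.cast_nonneg
    have := pi_pos
    refine sin_pos_of_pos_of_lt_pi (by positivity) ?_
    rw [Nat.cast_zero, zero_add, one_mul]
    exact div_lt_self pi_pos (by linarith)
  positivity

lemma integral_sineKernel_mul_cos (k : ℕ) :
    ∫ t in (0 : ℝ)..2 * π, sqKernel (sineWeight k) (k + 1) t * cos t =
      2 * π * cos (π / (k + 2)) * ∑ i ∈ range (k + 1), sineWeight k i ^ 2 := by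
  rw [integral_sqKernel_mul_cos, mul_sum, mul_sum]
  refine sum_congr rfl fun i hi => ?_
  rw [sineWeight_neighbours k i hi]
  ring

lemma integral_comp_add_of_periodic {F : ℝ → ℝ} {T : ℝ} (hF : Function.Periodic F T) (s : ℝ) :
    ∫ t in (0 : ℝ)..T, F (s + t) = ∫ t in (0 : ℝ)..T, F t := by
  rw [integral_comp_add_left, add_zero, hF.intervalIntegral_add_eq s 0, zero_add]

lemma integral_comp_sub_of_periodic {F : ℝ → ℝ} {T : ℝ} (hF : Function.Periodic F T) (s : ℝ) :
    ∫ t in (0 : ℝ)..T, F (s - t) = ∫ t in (0 : ℝ)..T, F t := by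
  rw [integral_comp_sub_left, sub_zero]
  have := hF.intervalIntegral_add_eq (s - T) 0
  rwa [sub_add_cancel, zero_add] at this

lemma sq_cos_sub_cos_le_sub (s t : ℝ) : (cos s - cos t) ^ 2 ≤ 2 * (1 - cos (s - t)) := by
  rw [cos_sub]
  nlinarith [sq_nonneg (sin s - sin t), sin_sq_add_cos_sq s, sin_sq_add_cos_sq t]

lemma sq_cos_sub_cos_le_add (s t : ℝ) : (cos s - cos t) ^ 2 ≤ 2 * (1 - cos (s + t)) := by
  simpa using sq_cos_sub_cos_le_sub s (-t)

/-- The symmetrized mean of `g` against the kernel. -/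
noncomputable def kernelMean (c : ℕ → ℝ) (n : ℕ) (g : ℝ → ℝ) (s : ℝ) : ℝ :=
  ∫ t in (0 : ℝ)..2 * π, g t * ((sqKernel c n (s - t) + sqKernel c n (s + t)) / 2)

lemma abs_sub_kernelMean_le (k : ℕ) (g : ℝ → ℝ) (hgc : Continuous g)
    (hg : ∀ s t, |g s - g t| ≤ |cos s - cos t|) (s : ℝ) :
    |g s - kernelMean (sineWeight k) (k + 1) g s /
      (2 * π * ∑ i ∈ range (k + 1), sineWeight k i ^ 2)| ≤ π / (k + 2) := by
  set S := ∑ i ∈ range (k + 1), sineWeight k i ^ 2 with hS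
  set K := sqKernel (sineWeight k) (k + 1) with hK
  set δ : ℝ := π / (k + 2) with hδ
  have hSpos : 0 < S := sum_sq_sineWeight_pos k
  have hδpos : 0 < δ := by
    have := pi_pos
    positivity
  have hKc : Continuous K := continuous_sqKernel _ _
  have hK0 : ∀ u, 0 ≤ K u := sqKernel_nonneg _ _
  have hKp : Function.Periodic K (2 * π) := sqKernel_periodic _ _
  have hKint : ∫ t in (0 : ℝ)..2 * π, K t = 2 * π * S := integral_sqKernel _ _
  have hπ : (0 : ℝ) < 2 * π := two_pi_pos
  have hden : 0 < 2 * π * S := by positivity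
  have mean_sym : ∀ F : ℝ → ℝ, Continuous F → Function.Periodic F (2 * π) →
      ∫ t in (0 : ℝ)..2 * π, (F (s - t) + F (s + t)) / 2 = ∫ t in (0 : ℝ)..2 * π, F t := by
    intro F hF hp
    rw [integral_div, integral_add (Continuous.intervalIntegrable (by fun_prop) _ _)
      (Continuous.intervalIntegrable (by fun_prop) _ _), integral_comp_add_of_periodic hp,
      integral_comp_sub_of_periodic hp]
    ring
  have hdiff : g s * (2 * π * S) - kernelMean (sineWeight k) (k + 1) g s =
      ∫ t in (0 : ℝ)..2 * π, (g s - g t) * ((K (s - t) + K (s + t)) / 2) := by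
    rw [← hKint, ← mean_sym K hKc hKp, ← integral_const_mul, kernelMean, ← hK, ← integral_sub
      (Continuous.intervalIntegrable (by fun_prop) _ _)
      (Continuous.intervalIntegrable (by fun_prop) _ _)]
    refine integral_congr fun t _ => ?_
    ring
  let F : ℝ → ℝ := fun u => (δ + 2 * (1 - cos u) / δ) / 2 * K u
  have hFc : Continuous F := by fun_prop
  have hFp : Function.Periodic F (2 * π) := by
    intro u
    simp only [F, hKp u, cos_add_two_pi]
  have hFint : ∫ t in (0 : ℝ)..2 * π, F t ≤ 2 * π * S * δ := by
    have : ∀ t, F t = (δ / 2 + 1 / δ) * K t - 1 / δ * (K t * cos t) := by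
      intro t
      simp only [F]
      field_simp
      ring
    simp_rw [this]
    rw [integral_sub (Continuous.intervalIntegrable (by fun_prop) _ _)
      (Continuous.intervalIntegrable (by fun_prop) _ _), integral_const_mul, integral_const_mul,
      hKint, integral_sineKernel_mul_cos, ← hS, ← hδ]
    have hcos := one_sub_sq_div_two_le_cos (x := δ)
    have : (1 - cos δ) / δ ≤ δ / 2 := by
      rw [div_le_iff₀ hδpos]
      nlinarith
    calc _ = 2 * π * S * (δ / 2 + (1 - cos δ) / δ) := by ring
      _ ≤ 2 * π * S * (δ / 2 + δ / 2) := by gcongr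
      _ = _ := by ring
  have amgm : ∀ x y : ℝ, x ^ 2 ≤ y → |x| ≤ (δ + y / δ) / 2 := by
    intro x y hxy
    have h1 : |x| ^ 2 ≤ y := by rwa [sq_abs]
    have h2 : δ * (y / δ) = y := by field_simp
    have h3 : 0 ≤ δ * ((δ + y / δ) / 2 - |x|) := by
      nlinarith [sq_nonneg (δ - |x|)]
    have := nonneg_of_mul_nonneg_right h3 hδpos
    linarith
  have hpt : ∀ t, |(g s - g t) * ((K (s - t) + K (s + t)) / 2)| ≤
      (F (s - t) + F (s + t)) / 2 := by
    intro t
    rw [abs_mul, abs_of_nonneg (a := (K (s - t) + K (s + t)) / 2)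
      (by linarith [hK0 (s - t), hK0 (s + t)])]
    have h1 := mul_le_mul_of_nonneg_right
      ((hg s t).trans (amgm _ _ (sq_cos_sub_cos_le_sub s t))) (hK0 (s - t))
    have h2 := mul_le_mul_of_nonneg_right
      ((hg s t).trans (amgm _ _ (sq_cos_sub_cos_le_add s t))) (hK0 (s + t))
    simp only [F]
    linarith
  have hmain : |g s * (2 * π * S) - kernelMean (sineWeight k) (k + 1) g s| ≤ 2 * π * S * δ := by
    rw [hdiff]
    refine (abs_integral_le_integral_abs hπ.le).trans (le_trans ?_ hFint)
    rw [← mean_sym F hFc hFp]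
    exact integral_mono_on hπ.le (Continuous.intervalIntegrable (by fun_prop) _ _)
      (Continuous.intervalIntegrable (by fun_prop) _ _) fun t _ => hpt t
  have : g s - kernelMean (sineWeight k) (k + 1) g s / (2 * π * S) =
      (g s * (2 * π * S) - kernelMean (sineWeight k) (k + 1) g s) / (2 * π * S) := by
    field_simp
  rw [this, abs_div, abs_of_pos hden, div_le_iff₀ hden]
  linarith

/-- The cosine moments of `g` over a period. -/
noncomputable def cosMoment (g : ℝ → ℝ) (r : ℕ) : ℝ := ∫ t in (0 : ℝ)..2 * π, g t * cos (r * t)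

lemma kernelMean_eq_sum (c : ℕ → ℝ) (n : ℕ) (g : ℝ → ℝ) (hgc : Continuous g) (s : ℝ) :
    kernelMean c n g s = ∑ r ∈ range n,
      (∑ p ∈ range n ×ˢ range n with ((p.1 : ℤ) - p.2).natAbs = r, c p.1 * c p.2) *
        cosMoment g r * cos (r * s) := by
  have hmap : ∀ p ∈ range n ×ˢ range n, ((p.1 : ℤ) - p.2).natAbs ∈ range n := by
    intro p hp
    rw [mem_product, mem_range, mem_range] at hp
    rw [mem_range]
    omega
  have hcos : ∀ (m : ℤ) (x : ℝ), cos (m.natAbs * x) = cos (m * x) := by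
    intro m x
    rw [Nat.cast_natAbs, Int.cast_abs]
    rcases abs_choice (m : ℝ) with h | h <;> simp [h]
  have hK : ∀ t, g t * ((sqKernel c n (s - t) + sqKernel c n (s + t)) / 2) =
      ∑ p ∈ range n ×ˢ range n, c p.1 * c p.2 * cos (((p.1 : ℤ) - p.2).natAbs * s) *
        (g t * cos (((p.1 : ℤ) - p.2).natAbs * t)) := by
    intro t
    rw [sum_product, sqKernel, sqKernel, ← sum_add_distrib, sum_div, mul_sum]
    refine sum_congr rfl fun i _ => ?_
    rw [← sum_add_distrib, sum_div, mul_sum]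
    refine sum_congr rfl fun j _ => ?_
    rw [hcos, hcos, mul_sub, mul_add, cos_add, cos_sub]
    ring
  simp_rw [kernelMean, hK]
  rw [integral_finsetSum (fun i _ => Continuous.intervalIntegrable (by fun_prop) _ _),
    ← sum_fiberwise_of_maps_to hmap]
  refine sum_congr rfl fun r _ => ?_
  rw [sum_mul, sum_mul]
  refine sum_congr rfl fun p hp => ?_
  rw [(mem_filter.1 hp).2, integral_const_mul, cosMoment]
  ring

lemma abs_sum_natAbs_sub_le (c : ℕ → ℝ) (n r : ℕ) :
    |∑ p ∈ range n ×ˢ range n with ((p.1 : ℤ) - p.2).natAbs = r, c p.1 * c p.2| ≤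
      2 * ∑ i ∈ range n, c i ^ 2 := by
  have hcard : ∀ i : ℕ, ((range n).filter fun j : ℕ => ((i : ℤ) - j).natAbs = r).card ≤ 2 := by
    intro i
    refine (card_le_card (t := {i + r, i - r}) fun j hj => ?_).trans card_le_two
    have := (mem_filter.1 hj).2
    rw [mem_insert, mem_singleton]
    omega
  have hbound : ∑ i ∈ range n, ∑ j ∈ range n,
      (if ((i : ℤ) - j).natAbs = r then c i ^ 2 else 0) ≤ 2 * ∑ i ∈ range n, c i ^ 2 := by
    rw [mul_sum]
    refine sum_le_sum fun i _ => ?_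
    rw [← sum_filter, sum_const, nsmul_eq_mul]
    exact mul_le_mul_of_nonneg_right (by exact_mod_cast hcard i) (sq_nonneg _)
  have hswap : ∑ i ∈ range n, ∑ j ∈ range n,
      (if ((i : ℤ) - j).natAbs = r then c j ^ 2 else 0) = ∑ i ∈ range n, ∑ j ∈ range n,
      (if ((i : ℤ) - j).natAbs = r then c i ^ 2 else 0) := by
    rw [sum_comm]
    refine sum_congr rfl fun i _ => sum_congr rfl fun j _ => ?_
    rw [← Int.natAbs_neg, neg_sub]
  refine le_trans ?_ hbound
  rw [sum_filter, sum_product]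
  calc _ ≤ ∑ i ∈ range n, ∑ j ∈ range n,
        ((if ((i : ℤ) - j).natAbs = r then c i ^ 2 else 0) +
          (if ((i : ℤ) - j).natAbs = r then c j ^ 2 else 0)) / 2 := by
        refine (abs_sum_le_sum_abs _ _).trans (sum_le_sum fun i _ => ?_)
        refine (abs_sum_le_sum_abs _ _).trans (sum_le_sum fun j _ => ?_)
        dsimp only
        split_ifs
        · rw [abs_le]
          constructor <;> nlinarith [sq_nonneg (c i - c j), sq_nonneg (c i + c j)]
        · simp
    _ = _ := by
        simp_rw [← sum_div, sum_add_distrib]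
        rw [hswap]
        ring

lemma abs_cosMoment_le (g : ℝ → ℝ) (hgc : Continuous g) (hgp : Function.Periodic g (2 * π))
    (hg : ∀ s t, |g s - g t| ≤ |cos s - cos t|) (r : ℕ) (hr : 1 ≤ r) :
    |cosMoment g r| ≤ π ^ 2 / (2 * r) := by
  have hr0 : (0 : ℝ) < r := by exact_mod_cast hr
  have hπ := pi_pos
  set h : ℝ := π / r with hh
  have hpos : 0 < h := by positivity
  have hp : Function.Periodic (fun t => g t * cos (r * t)) (2 * π) := by
    intro t
    simp only [hgp t, mul_add, cos_add_nat_mul_two_pi]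
  have hcos_sq : ∀ m : ℕ, m ≠ 0 → ∀ x : ℝ,
      ∫ t in (0 : ℝ)..2 * π, cos (2 * (m * t + x)) = 0 := by
    intro m hm x
    have hm' : (2 * m : ℝ) ≠ 0 := by positivity
    have := integral_comp_mul_add (a := 0) (b := 2 * π) (fun x => cos x) hm' (2 * x)
    rw [integral_cos, show (2 * m : ℝ) * (2 * π) + 2 * x = 2 * x + ((2 * m : ℕ) : ℝ) * (2 * π) by
      push_cast; ring, sin_add_nat_mul_two_pi] at this
    simp only [mul_zero, zero_add, sub_self, smul_zero] at this
    refine Eq.trans (integral_congr fun t _ => ?_) this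
    ring_nf
  have hshift : cosMoment g r = -∫ t in (0 : ℝ)..2 * π, g (h + t) * cos (r * t) := by
    rw [cosMoment, ← integral_comp_add_of_periodic hp h, ← integral_neg]
    refine integral_congr fun t _ => ?_
    rw [mul_add, show (r : ℝ) * h = π by rw [hh]; field_simp, add_comm π, cos_add_pi]
    ring
  have htwo : 2 * cosMoment g r = ∫ t in (0 : ℝ)..2 * π, (g t - g (h + t)) * cos (r * t) := by
    simp_rw [sub_mul]
    rw [integral_sub (Continuous.intervalIntegrable (by fun_prop) _ _)
      (Continuous.intervalIntegrable (by fun_prop) _ _), two_mul]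
    nth_rewrite 2 [hshift]
    rw [cosMoment]
    ring
  have hpt : ∀ t, |(g t - g (h + t)) * cos (r * t)| ≤
      h / 2 * (1 - cos (2 * ((1 : ℕ) * t + h / 2)) / 2 + cos (2 * (r * t + 0)) / 2) := by
    intro t
    have h1 : |g t - g (h + t)| ≤ h * |sin (t + h / 2)| := by
      refine (hg _ _).trans ?_
      rw [cos_sub_cos, show (t + (h + t)) / 2 = t + h / 2 by ring,
        show (t - (h + t)) / 2 = -(h / 2) by ring, sin_neg, abs_mul, abs_mul, abs_neg, abs_neg,
        abs_two]
      have := abs_sin_le_abs (x := h / 2)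
      rw [abs_of_pos (half_pos hpos)] at this
      nlinarith [abs_nonneg (sin (t + h / 2))]
    rw [abs_mul, Nat.cast_one, one_mul, add_zero, cos_two_mul, cos_two_mul]
    have h2 := mul_le_mul_of_nonneg_right h1 (abs_nonneg (cos (r * t)))
    have h3 := sin_sq_add_cos_sq (t + h / 2)
    have h4 : |sin (t + h / 2)| * |cos (r * t)| ≤
        (sin (t + h / 2) ^ 2 + cos (r * t) ^ 2) / 2 := by
      rw [← sq_abs (sin _), ← sq_abs (cos _)]
      nlinarith [sq_nonneg (|sin (t + h / 2)| - |cos (r * t)|)]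
    have h5 := mul_le_mul_of_nonneg_left h4 hpos.le
    rw [show sin (t + h / 2) ^ 2 = 1 - cos (t + h / 2) ^ 2 by linarith] at h5
    linarith
  have hint : |2 * cosMoment g r| ≤ h * π := by
    rw [htwo]
    refine (abs_integral_le_integral_abs two_pi_pos.le).trans ?_
    refine (integral_mono_on two_pi_pos.le (Continuous.intervalIntegrable (by fun_prop) _ _)
      (Continuous.intervalIntegrable (by fun_prop) _ _) fun t _ => hpt t).trans ?_
    rw [integral_const_mul, integral_add (Continuous.intervalIntegrable (by fun_prop) _ _)
      (Continuous.intervalIntegrable (by fun_prop) _ _),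
      integral_sub (Continuous.intervalIntegrable (by fun_prop) _ _)
      (Continuous.intervalIntegrable (by fun_prop) _ _), integral_div, integral_div,
      hcos_sq 1 one_ne_zero, hcos_sq r (by omega), integral_const]
    simp only [smul_eq_mul]
    linarith
  rw [abs_mul, abs_two] at hint
  have : π ^ 2 / (2 * r) = h * π / 2 := by
    rw [hh]
    field_simp
  linarith

end LipschitzChebyshev

open LipschitzChebyshev in
/-- **Jackson's theorem with coefficient bounds.** Every 1-Lipschitz
function on `[-1,1]` admits a degree-`k` Chebyshev approximation with error at most
`6/k`, whose coefficients satisfy `|a_r| ≤ 2/r` for `1 ≤ r ≤ k`. -/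
theorem chebyshev_approximation_of_lipschitz
    (f : ℝ → ℝ)
    (hf : ∀ x ∈ Set.Icc (-1 : ℝ) 1, ∀ y ∈ Set.Icc (-1 : ℝ) 1, |f x - f y| ≤ |x - y|)
    (k : ℕ) (hk : 1 ≤ k) :
    ∃ a : ℕ → ℝ,
      (∀ r : ℕ, 1 ≤ r → r ≤ k → |a r| ≤ 2 / r) ∧
      ∀ θ ∈ Set.Icc (-1 : ℝ) 1,
        |f θ - ∑ r ∈ Finset.range (k + 1),
            a r * (Polynomial.Chebyshev.T ℝ (r : ℤ)).eval θ| ≤ 6 / k := by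
  have hπ := Real.pi_pos
  have hπ4 := Real.pi_le_four
  have hk0 : (0 : ℝ) < k := by exact_mod_cast hk
  let g : ℝ → ℝ := fun t => f (Real.cos t)
  have hg : ∀ s t, |g s - g t| ≤ |Real.cos s - Real.cos t| := fun s t =>
    hf _ (Real.cos_mem_Icc s) _ (Real.cos_mem_Icc t)
  have hgp : Function.Periodic g (2 * Real.pi) := fun t => by simp [g]
  have hgc : Continuous g := by
    have hfc : ContinuousOn f (Set.Icc (-1) 1) :=
      (LipschitzOnWith.of_dist_le_mul (K := 1) fun x hx y hy => by
        simpa [Real.dist_eq] using hf x hx y hy).continuousOn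
    exact hfc.comp_continuous Real.continuous_cos Real.cos_mem_Icc
  set S := ∑ i ∈ Finset.range (k + 1), sineWeight k i ^ 2 with hS
  have hSpos : 0 < S := sum_sq_sineWeight_pos k
  have hden : 0 < 2 * Real.pi * S := by positivity
  refine ⟨fun r => (∑ p ∈ Finset.range (k + 1) ×ˢ Finset.range (k + 1) with
    ((p.1 : ℤ) - p.2).natAbs = r, sineWeight k p.1 * sineWeight k p.2) *
      cosMoment g r / (2 * Real.pi * S), fun r hr _ => ?_, fun θ hθ => ?_⟩
  · have hr0 : (0 : ℝ) < r := by exact_mod_cast hr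
    rw [abs_div, abs_of_pos hden, div_le_iff₀ hden, abs_mul]
    calc _ ≤ 2 * S * (Real.pi ^ 2 / (2 * r)) :=
          mul_le_mul (abs_sum_natAbs_sub_le _ _ _) (abs_cosMoment_le g hgc hgp hg r hr)
            (abs_nonneg _) (by positivity)
      _ = S * Real.pi / r * Real.pi := by
          field_simp
      _ ≤ S * Real.pi / r * 4 := by gcongr
      _ = _ := by
          field_simp
          norm_num
  · have hcos : Real.cos (Real.arccos θ) = θ := Real.cos_arccos hθ.1 hθ.2
    have hmean := abs_sub_kernelMean_le k g hgc hg (Real.arccos θ)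
    rw [kernelMean_eq_sum _ _ g hgc, Finset.sum_div] at hmean
    have hsum : ∀ r : ℕ, (Polynomial.Chebyshev.T ℝ (r : ℤ)).eval θ =
        Real.cos (r * Real.arccos θ) := by
      intro r
      conv_lhs => rw [← hcos]
      rw [Polynomial.Chebyshev.T_real_cos, Int.cast_natCast]
    simp only [hsum, div_mul_eq_mul_div]
    simp only [g, hcos] at hmean
    refine hmean.trans ?_
    rw [div_le_div_iff₀ (by positivity) hk0]
    nlinarith
end

section
/- Let μ and ν be Borel probability measures on [−1,1] and let k ≥ 1 be an integer. Then for every 1-Lipschitz function f : [−1,1] → ℝ, ∫ f dν − ∫ f dμ ≤ 12/k + Σ_{r=1}^{k} (2/r)·|∫ T_r dν − ∫ T_r dμ|. Consequently, the Wasserstein-1 distance between ν and μ (the supremum of ∫ f dν − ∫ f dμ over 1-Lipschitz f) is at most 12/k + Σ_{r=1}^{k} (2/r)·|∫ T_r dν − ∫ T_r dμ|. -/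
open MeasureTheory Polynomial

/-- Telescoping form of the sum of cosines along an arithmetic progression. -/
lemma two_mul_sin_mul_sum_cos (x δ : ℝ) (n : ℕ) :
    2 * Real.sin (δ / 2) * ∑ m ∈ Finset.range n, Real.cos (x + m * δ) =
      Real.sin (x + n * δ - δ / 2) - Real.sin (x - δ / 2) := by
  induction n with
  | zero => simp
  | succ n ih =>
    rw [Finset.sum_range_succ, mul_add, ih]
    have e : x + ((n + 1 : ℕ) : ℝ) * δ - δ / 2 = (x + n * δ) + δ / 2 := by push_cast; ring
    rw [e, Real.sin_add, Real.sin_sub (x + n * δ)]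
    ring

/-- The `m`-th of `N` equally spaced angles. -/
noncomputable def gridAngle (N m : ℕ) : ℝ := 2 * Real.pi * m / N

lemma sum_cos_gridAngle (N : ℕ) (x : ℝ) (r : ℤ) (hr : r ≠ 0) (hrN : |r| < N) :
    ∑ m ∈ Finset.range N, Real.cos (x + r * gridAngle N m) = 0 := by
  have hN : (0 : ℝ) < N := by
    have : (0 : ℤ) < N := lt_of_le_of_lt (abs_nonneg r) hrN
    exact_mod_cast this
  set δ : ℝ := 2 * Real.pi * r / N with hδ
  have hs : Real.sin (δ / 2) ≠ 0 := by
    have e : δ / 2 = Real.pi * (r / N) := by rw [hδ]; ring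
    rw [e, Ne, Real.sin_eq_zero_iff]
    rintro ⟨n, hn⟩
    have h1 : (n : ℝ) * N = r := by
      have : (n : ℝ) = r / N :=
        mul_left_cancel₀ Real.pi_ne_zero (by rw [← hn]; ring)
      rw [this]; field_simp
    have h2 : n * (N : ℤ) = r := by exact_mod_cast h1
    have hn0 : n ≠ 0 := by rintro rfl; simp at h2; exact hr h2.symm
    have h3 : 1 ≤ |n| := Int.one_le_abs hn0
    have h4 : |r| = |n| * N := by rw [← h2, abs_mul, Nat.abs_cast]
    nlinarith
  have h := two_mul_sin_mul_sum_cos x δ N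
  have e : x + N * δ - δ / 2 = (x - δ / 2) + r * (2 * Real.pi) := by
    rw [hδ]; field_simp; ring
  rw [e, Real.sin_add_int_mul_two_pi, sub_self] at h
  have h' := (mul_eq_zero.mp h).resolve_left (by simpa using hs)
  rw [← h']
  refine Finset.sum_congr rfl fun m _ => ?_
  congr 1
  rw [hδ, gridAngle]; ring

lemma sum_cos_gridAngle_eq_ite (N : ℕ) (x : ℝ) (r : ℤ) (hrN : |r| < N) :
    ∑ m ∈ Finset.range N, Real.cos (r * (x + gridAngle N m)) = if r = 0 then (N : ℝ) else 0 := by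
  split_ifs with h
  · simp [h]
  · simp_rw [mul_add]
    exact sum_cos_gridAngle N _ r h hrN

/-- A sum over a full period is invariant under shifts. -/
lemma sum_range_shift (F : ℕ → ℝ) (N q : ℕ) (hF : ∀ m, F (m + N) = F m) :
    ∑ m ∈ Finset.range N, F (m + q) = ∑ m ∈ Finset.range N, F m := by
  induction q with
  | zero => simp
  | succ q ih =>
    rw [← ih]
    have h1 := Finset.sum_range_succ (fun m => F (m + q)) N
    rw [Finset.sum_range_succ'] at h1
    have h2 : F (N + q) = F (0 + q) := by rw [add_comm, hF, zero_add]
    have h3 : ∀ m, F (m + (q + 1)) = F (m + 1 + q) := fun m => by congr 1; ring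
    simp_rw [h3]
    linarith

/-- Discrete Chebyshev coefficient of `f`. -/
noncomputable def gridCoeff (f : ℝ → ℝ) (N : ℕ) (r : ℤ) : ℝ :=
  (∑ m ∈ Finset.range N, f (Real.cos (gridAngle N m)) * Real.cos (r * gridAngle N m)) / N

lemma gridCoeff_abs (f : ℝ → ℝ) (N : ℕ) (r : ℤ) : gridCoeff f N |r| = gridCoeff f N r := by
  rcases abs_choice r with h | h <;> rw [h]
  simp [gridCoeff]

/-- The discrete Chebyshev coefficients of a Lipschitz function decay like `1 / r`. -/
lemma abs_gridCoeff_le (f : ℝ → ℝ)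
    (hf : ∀ x ∈ Set.Icc (-1 : ℝ) 1, ∀ y ∈ Set.Icc (-1 : ℝ) 1, |f x - f y| ≤ |x - y|)
    (N r q : ℕ) (hr : 1 ≤ r) (hN : N = 2 * r * q) (hrN : 2 * r < N) :
    |gridCoeff f N r| ≤ 1 / r := by
  have hrpos : (0 : ℝ) < r := by exact_mod_cast hr
  have hNpos : (0 : ℝ) < N := by exact_mod_cast (by omega : 0 < N)
  set φ := gridAngle N with hφ
  set h : ℝ := Real.pi / r with hh
  have hhpos : 0 < h := by positivity
  have shift : ∀ m, φ (m + q) = φ m + h := by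
    intro m
    have hNR : (N : ℝ) = 2 * r * q := by exact_mod_cast hN
    have hq : (q : ℝ) ≠ 0 := by rintro h0; rw [h0] at hNR; linarith
    rw [hφ, hh]; simp only [gridAngle]; rw [hNR]; push_cast; field_simp
  have per : ∀ m, φ (m + N) = φ m + 2 * Real.pi := by
    intro m; rw [hφ]; simp only [gridAngle]; push_cast; field_simp
  set F : ℕ → ℝ := fun m => f (Real.cos (φ m)) * Real.cos (r * φ m) with hF
  have hFper : ∀ m, F (m + N) = F m := by
    intro m
    simp only [hF, per, Real.cos_add_two_pi, mul_add, Real.cos_add_nat_mul_two_pi]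
  have hFq : ∀ m, F (m + q) = - (f (Real.cos (φ m + h)) * Real.cos (r * φ m)) := by
    intro m
    have : (r : ℝ) * h = Real.pi := by rw [hh]; field_simp
    simp only [hF, shift, mul_add, this, Real.cos_add_pi]; ring
  have hterm : ∀ m, |F m + F (m + q)| ≤
      h / 2 * (1 - Real.cos (h + (2 : ℤ) * φ m) / 2 + Real.cos (0 + (2 * r : ℤ) * φ m) / 2) := by
    intro m
    rw [hFq]
    have e1 : F m + -(f (Real.cos (φ m + h)) * Real.cos (r * φ m)) =
        (f (Real.cos (φ m)) - f (Real.cos (φ m + h))) * Real.cos (r * φ m) := by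
      simp only [hF]; ring
    rw [e1, abs_mul]
    have e2 := hf _ (Real.cos_mem_Icc (φ m)) _ (Real.cos_mem_Icc (φ m + h))
    have e3 : |Real.cos (φ m) - Real.cos (φ m + h)| ≤ h * |Real.sin (φ m + h / 2)| := by
      rw [Real.cos_sub_cos]
      have a1 : (φ m + (φ m + h)) / 2 = φ m + h / 2 := by ring
      have a2 : (φ m - (φ m + h)) / 2 = -(h / 2) := by ring
      rw [a1, a2, Real.sin_neg, abs_mul, abs_mul, abs_neg, abs_neg]
      have a3 : |Real.sin (h / 2)| ≤ h / 2 := by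
        have := Real.abs_sin_le_abs (x := h / 2)
        rwa [abs_of_pos (by positivity : 0 < h / 2)] at this
      have a4 : |(2 : ℝ)| = 2 := by norm_num
      rw [a4]
      nlinarith [abs_nonneg (Real.sin (φ m + h / 2))]
    have e4 : Real.cos (h + (2 : ℤ) * φ m) = 1 - 2 * |Real.sin (φ m + h / 2)| ^ 2 := by
      have : h + ((2 : ℤ) : ℝ) * φ m = 2 * (φ m + h / 2) := by push_cast; ring
      rw [this, sq_abs, Real.cos_two_mul, Real.cos_sq']; ring
    have e5 : Real.cos (0 + ((2 * r : ℤ) : ℝ) * φ m) = 2 * |Real.cos (r * φ m)| ^ 2 - 1 := by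
      have : 0 + ((2 * r : ℤ) : ℝ) * φ m = 2 * (r * φ m) := by push_cast; ring
      rw [this, sq_abs, Real.cos_two_mul]
    rw [e4, e5]
    calc _ ≤ h * |Real.sin (φ m + h / 2)| * |Real.cos (r * φ m)| :=
          mul_le_mul_of_nonneg_right (e2.trans e3) (abs_nonneg _)
      _ ≤ _ := by
          nlinarith [mul_nonneg hhpos.le
            (sq_nonneg (|Real.sin (φ m + h / 2)| - |Real.cos (r * φ m)|))]
  have hsum : 2 * ∑ m ∈ Finset.range N, F m = ∑ m ∈ Finset.range N, (F m + F (m + q)) := by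
    rw [Finset.sum_add_distrib, sum_range_shift F N q hFper]; ring
  have hbound : |2 * ∑ m ∈ Finset.range N, F m| ≤ h / 2 * N := by
    rw [hsum]
    refine (Finset.abs_sum_le_sum_abs _ _).trans ((Finset.sum_le_sum fun m _ => hterm m).trans ?_)
    rw [← Finset.mul_sum, Finset.sum_add_distrib, Finset.sum_sub_distrib, ← Finset.sum_div,
      ← Finset.sum_div, sum_cos_gridAngle N h 2 (by norm_num) (by norm_num; omega),
      sum_cos_gridAngle N 0 (2 * r) (by omega) (by rw [abs_of_nonneg (by omega)]; omega)]
    simp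
  have : gridCoeff f N r = (∑ m ∈ Finset.range N, F m) / N := by
    simp [gridCoeff, hF, hφ]
  rw [this, abs_div, abs_of_pos hNpos, div_le_iff₀ hNpos]
  rw [abs_mul, abs_of_pos (by norm_num : (0 : ℝ) < 2)] at hbound
  have hle : h ≤ 4 * (1 / r) := by
    rw [hh, mul_one_div]; gcongr; exact Real.pi_le_four
  nlinarith

/-- Coefficients of the Fejér–Korovkin kernel of degree `k`. -/
noncomputable def korovkinCoeff (k j : ℕ) : ℝ := Real.sin ((j + 1) * (Real.pi / (k + 2)))

/-- Squared norm of the coefficients of the Fejér–Korovkin kernel. -/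
noncomputable def korovkinMass (k : ℕ) : ℝ := ∑ j ∈ Finset.range (k + 1), korovkinCoeff k j ^ 2

/-- The unnormalised Fejér–Korovkin kernel of degree `k`. -/
noncomputable def korovkinKernel (k : ℕ) (t : ℝ) : ℝ :=
  ∑ j ∈ Finset.range (k + 1), ∑ l ∈ Finset.range (k + 1),
    korovkinCoeff k j * korovkinCoeff k l * Real.cos (((j - l : ℤ) : ℝ) * t)

lemma korovkinCoeff_pos (k j : ℕ) (hj : j < k + 1) : 0 < korovkinCoeff k j := by
  refine Real.sin_pos_of_pos_of_lt_pi (by positivity) ?_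
  have h : (j : ℝ) + 1 < k + 2 := by exact_mod_cast (by omega : j + 1 < k + 2)
  have hk : (0 : ℝ) < k + 2 := by positivity
  rw [mul_div_assoc', div_lt_iff₀ hk]
  nlinarith [Real.pi_pos]

lemma korovkinMass_pos (k : ℕ) : 0 < korovkinMass k :=
  Finset.sum_pos (fun j hj => pow_pos (korovkinCoeff_pos k j (Finset.mem_range.mp hj)) 2) (by simp)

lemma korovkinKernel_nonneg (k : ℕ) (t : ℝ) : 0 ≤ korovkinKernel k t := by
  have : korovkinKernel k t =
      (∑ j ∈ Finset.range (k + 1), korovkinCoeff k j * Real.cos (j * t)) ^ 2 +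
        (∑ j ∈ Finset.range (k + 1), korovkinCoeff k j * Real.sin (j * t)) ^ 2 := by
    rw [sq, sq, Finset.sum_mul_sum, Finset.sum_mul_sum, ← Finset.sum_add_distrib]
    refine Finset.sum_congr rfl fun j _ => ?_
    rw [← Finset.sum_add_distrib]
    refine Finset.sum_congr rfl fun l _ => ?_
    push_cast
    rw [sub_mul, Real.cos_sub]; ring
  rw [this]; positivity

lemma korovkinKernel_neg (k : ℕ) (t : ℝ) : korovkinKernel k (-t) = korovkinKernel k t := by
  simp [korovkinKernel]

lemma sum_korovkinKernel (k N : ℕ) (hN : k < N) (x : ℝ) :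
    ∑ m ∈ Finset.range N, korovkinKernel k (x + gridAngle N m) = N * korovkinMass k := by
  simp_rw [korovkinKernel]
  rw [Finset.sum_comm, korovkinMass, Finset.mul_sum]
  refine Finset.sum_congr rfl fun j hj => ?_
  rw [Finset.sum_comm]
  have hj := Finset.mem_range.mp hj
  rw [Finset.sum_eq_single_of_mem j (Finset.mem_range.mpr hj)]
  · simp only [sub_self, Int.cast_zero, zero_mul, Real.cos_zero, Finset.sum_const,
      Finset.card_range, nsmul_eq_mul]
    ring
  · intro l hl hlj
    have hl := Finset.mem_range.mp hl
    rw [← Finset.mul_sum, sum_cos_gridAngle_eq_ite N x _ (by rw [abs_lt]; omega),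
      if_neg (by omega), mul_zero]

/-- The coefficients are an eigenvector of the path adjacency matrix. -/
lemma sum_korovkinCoeff_neighbours (k j : ℕ) (hj : j < k + 1) :
    ∑ l ∈ Finset.range (k + 1), korovkinCoeff k l *
      ((if (j - l + 1 : ℤ) = 0 then 1 else 0) + (if (j - l - 1 : ℤ) = 0 then 1 else 0)) =
      2 * Real.cos (Real.pi / (k + 2)) * korovkinCoeff k j := by
  have h1 : ∑ l ∈ Finset.range (k + 1), korovkinCoeff k l *
      (if (j - l + 1 : ℤ) = 0 then 1 else 0) = Real.sin ((j + 2) * (Real.pi / (k + 2))) := by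
    have : ∀ l : ℕ, ((j - l + 1 : ℤ) = 0) ↔ l = j + 1 := fun l => by omega
    simp only [this, mul_ite, mul_one, mul_zero, Finset.sum_ite_eq', Finset.mem_range]
    split_ifs with h
    · simp only [korovkinCoeff]; push_cast; congr 1; ring
    · have : j = k := by omega
      subst this
      rw [mul_div_cancel₀ _ (by positivity), Real.sin_pi]
  have h2 : ∑ l ∈ Finset.range (k + 1), korovkinCoeff k l *
      (if (j - l - 1 : ℤ) = 0 then 1 else 0) = Real.sin (j * (Real.pi / (k + 2))) := by
    rcases j with _ | j
    · simp only [Nat.cast_zero, zero_mul, Real.sin_zero]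
      refine Finset.sum_eq_zero fun l _ => ?_
      rw [if_neg (by omega), mul_zero]
    · have : ∀ l : ℕ, ((((j + 1 : ℕ) : ℤ) - l - 1 : ℤ) = 0) ↔ l = j := fun l => by omega
      simp only [this, mul_ite, mul_one, mul_zero, Finset.sum_ite_eq', Finset.mem_range]
      rw [if_pos (by omega), korovkinCoeff]; push_cast; rfl
  simp_rw [mul_add]
  rw [Finset.sum_add_distrib, h1, h2, korovkinCoeff]
  set α := Real.pi / (k + 2)
  have e1 : ((j : ℝ) + 2) * α = (j + 1) * α + α := by ring
  have e2 : (j : ℝ) * α = (j + 1) * α - α := by ring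
  rw [e1, e2, Real.sin_add, Real.sin_sub]; ring

lemma sum_korovkinKernel_mul_cos (k N : ℕ) (hN : k + 1 < N) (x : ℝ) :
    ∑ m ∈ Finset.range N, korovkinKernel k (x + gridAngle N m) * Real.cos (x + gridAngle N m) =
      N * korovkinMass k * Real.cos (Real.pi / (k + 2)) := by
  simp_rw [korovkinKernel, Finset.sum_mul]
  rw [Finset.sum_comm, korovkinMass, Finset.mul_sum, Finset.sum_mul]
  refine Finset.sum_congr rfl fun j hj => ?_
  rw [Finset.sum_comm]
  have hj := Finset.mem_range.mp hj
  have key : ∀ l ∈ Finset.range (k + 1), ∑ m ∈ Finset.range N,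
      korovkinCoeff k j * korovkinCoeff k l *
        Real.cos (((j - l : ℤ) : ℝ) * (x + gridAngle N m)) * Real.cos (x + gridAngle N m) =
      N / 2 * korovkinCoeff k j * (korovkinCoeff k l *
      ((if (j - l + 1 : ℤ) = 0 then 1 else 0) + (if (j - l - 1 : ℤ) = 0 then 1 else 0))) := by
    intro l hl
    have hl := Finset.mem_range.mp hl
    have e : ∀ m, korovkinCoeff k j * korovkinCoeff k l *
        Real.cos (((j - l : ℤ) : ℝ) * (x + gridAngle N m)) * Real.cos (x + gridAngle N m) =
        korovkinCoeff k j * korovkinCoeff k l / 2 *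
          (Real.cos (((j - l + 1 : ℤ) : ℝ) * (x + gridAngle N m)) +
            Real.cos (((j - l - 1 : ℤ) : ℝ) * (x + gridAngle N m))) := by
      intro m
      have a1 : ((j - l + 1 : ℤ) : ℝ) * (x + gridAngle N m) =
        ((j - l : ℤ) : ℝ) * (x + gridAngle N m) + (x + gridAngle N m) := by push_cast; ring
      have a2 : ((j - l - 1 : ℤ) : ℝ) * (x + gridAngle N m) =
        ((j - l : ℤ) : ℝ) * (x + gridAngle N m) - (x + gridAngle N m) := by push_cast; ring
      rw [a1, a2]
      generalize x + gridAngle N m = t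
      rw [Real.cos_add, Real.cos_sub]; ring
    simp_rw [e]
    rw [← Finset.mul_sum, Finset.sum_add_distrib,
      sum_cos_gridAngle_eq_ite N x _ (by rw [abs_lt]; omega),
      sum_cos_gridAngle_eq_ite N x _ (by rw [abs_lt]; omega)]
    split_ifs <;> ring
  rw [Finset.sum_congr rfl key, ← Finset.mul_sum, sum_korovkinCoeff_neighbours k j hj]
  ring

/-- First absolute moment of the kernel. -/
lemma sum_korovkinKernel_mul_abs_le (k N : ℕ) (hN : k + 1 < N) (x : ℝ) :
    ∑ m ∈ Finset.range N, korovkinKernel k (x + gridAngle N m) *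
      |Real.cos (gridAngle N m) - Real.cos x| ≤ N * korovkinMass k * (Real.pi / (k + 2)) := by
  set ε : ℝ := Real.pi / (k + 2) with hε
  have hεpos : 0 < ε := by positivity
  have hterm : ∀ m, korovkinKernel k (x + gridAngle N m) *
      |Real.cos (gridAngle N m) - Real.cos x| ≤
      (1 / ε + ε / 2) * korovkinKernel k (x + gridAngle N m) -
        1 / ε * (korovkinKernel k (x + gridAngle N m) * Real.cos (x + gridAngle N m)) := by
    intro m
    set φ := gridAngle N m
    set u := |Real.cos φ - Real.cos x| with hu
    have hu2 : u ^ 2 ≤ 2 * (1 - Real.cos (x + φ)) := by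
      rw [hu, sq_abs, Real.cos_add]
      nlinarith [sq_nonneg (Real.sin φ + Real.sin x), Real.sin_sq_add_cos_sq φ,
        Real.sin_sq_add_cos_sq x]
    have h1 : u ≤ (1 / ε + ε / 2) - 1 / ε * Real.cos (x + φ) := by
      have : u ≤ u ^ 2 / (2 * ε) + ε / 2 := by
        rw [← sub_nonneg]
        have : u ^ 2 / (2 * ε) + ε / 2 - u = (u - ε) ^ 2 / (2 * ε) := by field_simp; ring
        rw [this]; positivity
      refine this.trans ?_
      have : u ^ 2 / (2 * ε) ≤ 2 * (1 - Real.cos (x + φ)) / (2 * ε) := by gcongr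
      have e : 2 * (1 - Real.cos (x + φ)) / (2 * ε) = 1 / ε - 1 / ε * Real.cos (x + φ) := by
        field_simp
      linarith
    nlinarith [mul_le_mul_of_nonneg_left h1 (korovkinKernel_nonneg k (x + φ))]
  refine (Finset.sum_le_sum fun m _ => hterm m).trans ?_
  rw [Finset.sum_sub_distrib, ← Finset.mul_sum, ← Finset.mul_sum,
    sum_korovkinKernel k N (by omega), sum_korovkinKernel_mul_cos k N hN, ← hε]
  have hcos := Real.one_sub_sq_div_two_le_cos (x := ε)
  have hNM : 0 ≤ N * korovkinMass k := mul_nonneg (Nat.cast_nonneg _) (korovkinMass_pos k).le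
  have h2 : (1 / ε + ε / 2) - 1 / ε * Real.cos ε ≤ ε := by
    have : 1 / ε * (1 - Real.cos ε) ≤ 1 / ε * (ε ^ 2 / 2) := by gcongr; linarith
    have e : 1 / ε * (ε ^ 2 / 2) = ε / 2 := by field_simp
    linarith
  nlinarith [mul_le_mul_of_nonneg_left h2 hNM]

/-- Polynomial of degree at most `k` approximating `f` on `[-1, 1]`. -/
noncomputable def korovkinApprox (f : ℝ → ℝ) (k N : ℕ) (x : ℝ) : ℝ :=
  (∑ j ∈ Finset.range (k + 1), ∑ l ∈ Finset.range (k + 1),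
    korovkinCoeff k j * korovkinCoeff k l * gridCoeff f N (j - l : ℤ) *
      (Chebyshev.T ℝ (j - l : ℤ)).eval x) / korovkinMass k

lemma korovkinApprox_cos (f : ℝ → ℝ) (k N : ℕ) (θ : ℝ) :
    korovkinApprox f k N (Real.cos θ) = (∑ m ∈ Finset.range N, f (Real.cos (gridAngle N m)) *
      ((korovkinKernel k (θ + gridAngle N m) + korovkinKernel k (-θ + gridAngle N m)) / 2)) /
        N / korovkinMass k := by
  rw [korovkinApprox]
  congr 1
  simp_rw [korovkinKernel, Chebyshev.T_real_cos, gridCoeff, ← Finset.sum_add_distrib,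
    Finset.sum_div, Finset.mul_sum, Finset.sum_mul, Finset.sum_div]
  rw [Finset.sum_comm' (s := Finset.range N) (t' := Finset.range (k + 1))
    (s' := fun _ => Finset.range N) (by simp [and_comm])]
  refine Finset.sum_congr rfl fun j _ => ?_
  rw [Finset.sum_comm]
  refine Finset.sum_congr rfl fun m _ => Finset.sum_congr rfl fun l _ => ?_
  rw [mul_add, mul_add, Real.cos_add, Real.cos_add, mul_neg, Real.cos_neg, Real.sin_neg]
  ring

lemma abs_sub_korovkinApprox_le (f : ℝ → ℝ)
    (hf : ∀ x ∈ Set.Icc (-1 : ℝ) 1, ∀ y ∈ Set.Icc (-1 : ℝ) 1, |f x - f y| ≤ |x - y|)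
    (k N : ℕ) (hN : k + 1 < N) (x : ℝ) (hx : x ∈ Set.Icc (-1 : ℝ) 1) :
    |f x - korovkinApprox f k N x| ≤ Real.pi / (k + 2) := by
  obtain ⟨θ, rfl⟩ : ∃ θ, Real.cos θ = x := ⟨_, Real.cos_arccos hx.1 hx.2⟩
  have hNpos : (0 : ℝ) < N := by exact_mod_cast (by omega : 0 < N)
  have hS := korovkinMass_pos k
  set L : ℕ → ℝ := fun m =>
    (korovkinKernel k (θ + gridAngle N m) + korovkinKernel k (-θ + gridAngle N m)) / 2 with hL
  have hL0 : ∀ m, 0 ≤ L m := fun m => by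
    have h1 := korovkinKernel_nonneg k (θ + gridAngle N m)
    have h2 := korovkinKernel_nonneg k (-θ + gridAngle N m)
    simp only [hL]; positivity
  have hL1 : ∑ m ∈ Finset.range N, L m = N * korovkinMass k := by
    simp only [hL]
    rw [← Finset.sum_div, Finset.sum_add_distrib, sum_korovkinKernel k N (by omega),
      sum_korovkinKernel k N (by omega)]
    ring
  have hL2 : ∑ m ∈ Finset.range N, L m * |Real.cos (gridAngle N m) - Real.cos θ| ≤
      N * korovkinMass k * (Real.pi / (k + 2)) := by
    have h1 := sum_korovkinKernel_mul_abs_le k N hN θ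
    have h2 := sum_korovkinKernel_mul_abs_le k N hN (-θ)
    rw [Real.cos_neg] at h2
    have e : ∀ m, L m * |Real.cos (gridAngle N m) - Real.cos θ| =
      (korovkinKernel k (θ + gridAngle N m) * |Real.cos (gridAngle N m) - Real.cos θ| +
        korovkinKernel k (-θ + gridAngle N m) * |Real.cos (gridAngle N m) - Real.cos θ|) / 2 :=
      fun m => by simp only [hL]; ring
    simp_rw [e]
    rw [← Finset.sum_div, Finset.sum_add_distrib]
    linarith
  have e : f (Real.cos θ) - korovkinApprox f k N (Real.cos θ) =
      (∑ m ∈ Finset.range N, L m * (f (Real.cos θ) - f (Real.cos (gridAngle N m)))) /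
        (N * korovkinMass k) := by
    rw [korovkinApprox_cos, eq_div_iff (by positivity)]
    simp_rw [mul_sub]
    rw [Finset.sum_sub_distrib, ← Finset.sum_mul, hL1]
    simp_rw [mul_comm (L _)]
    field_simp
    congr 1
    exact Finset.sum_congr rfl fun m _ => by simp only [hL]; ring
  rw [e, abs_div, abs_of_pos (by positivity : 0 < N * korovkinMass k),
    div_le_iff₀ (by positivity), mul_comm (Real.pi / _)]
  refine (Finset.abs_sum_le_sum_abs _ _).trans (le_trans (Finset.sum_le_sum fun m _ => ?_) hL2)
  rw [abs_mul, abs_of_nonneg (hL0 m), abs_sub_comm (Real.cos (gridAngle N m))]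
  exact mul_le_mul_of_nonneg_left
    (hf _ (Real.cos_mem_Icc _) _ (Real.cos_mem_Icc _)) (hL0 m)

lemma sum_natAbs_sub_le (w : ℕ → ℝ) (hw : ∀ r, 0 ≤ w r) (hw0 : w 0 = 0) (k j : ℕ)
    (hj : j < k + 1) :
    ∑ l ∈ Finset.range (k + 1), w (j - l : ℤ).natAbs ≤ 2 * ∑ r ∈ Finset.Icc 1 k, w r := by
  rw [Finset.range_eq_Ico, ← Finset.sum_Ico_consecutive _ (Nat.zero_le j) hj.le,
    Finset.sum_eq_sum_Ico_succ_bot hj]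
  have h1 : ∑ l ∈ Finset.Ico 0 j, w (j - l : ℤ).natAbs ≤ ∑ r ∈ Finset.Icc 1 k, w r := by
    rw [← Finset.sum_image (f := w) (g := fun l : ℕ => (j - l : ℤ).natAbs)]
    · refine Finset.sum_le_sum_of_subset_of_nonneg ?_ fun _ _ _ => hw _
      intro r hr
      simp only [Finset.mem_image, Finset.mem_Ico, Finset.mem_Icc] at hr ⊢
      omega
    · intro a ha b hb hab
      simp only [Finset.coe_Ico, Set.mem_Ico] at ha hb hab
      omega
  have h2 : ∑ l ∈ Finset.Ico (j + 1) (k + 1), w (j - l : ℤ).natAbs ≤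
      ∑ r ∈ Finset.Icc 1 k, w r := by
    rw [← Finset.sum_image (f := w) (g := fun l : ℕ => (j - l : ℤ).natAbs)]
    · refine Finset.sum_le_sum_of_subset_of_nonneg ?_ fun _ _ _ => hw _
      intro r hr
      simp only [Finset.mem_image, Finset.mem_Ico, Finset.mem_Icc] at hr ⊢
      omega
    · intro a ha b hb hab
      simp only [Finset.coe_Ico, Set.mem_Ico] at ha hb hab
      omega
  simp only [sub_self, Int.natAbs_zero, hw0]
  linarith

/-- Schur-type bound for a nonnegative Toeplitz form. -/
lemma sum_mul_mul_natAbs_sub_le (a w : ℕ → ℝ) (hw : ∀ r, 0 ≤ w r) (hw0 : w 0 = 0) (k : ℕ) :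
    ∑ j ∈ Finset.range (k + 1), ∑ l ∈ Finset.range (k + 1), a j * a l * w (j - l : ℤ).natAbs ≤
      (∑ j ∈ Finset.range (k + 1), a j ^ 2) * (2 * ∑ r ∈ Finset.Icc 1 k, w r) := by
  have h1 : ∑ j ∈ Finset.range (k + 1), ∑ l ∈ Finset.range (k + 1),
      a j ^ 2 * w (j - l : ℤ).natAbs ≤
      (∑ j ∈ Finset.range (k + 1), a j ^ 2) * (2 * ∑ r ∈ Finset.Icc 1 k, w r) := by
    rw [Finset.sum_mul]
    refine Finset.sum_le_sum fun j hj => ?_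
    rw [← Finset.mul_sum]
    exact mul_le_mul_of_nonneg_left
      (sum_natAbs_sub_le w hw hw0 k j (Finset.mem_range.mp hj)) (sq_nonneg _)
  have h2 : ∑ j ∈ Finset.range (k + 1), ∑ l ∈ Finset.range (k + 1),
      a l ^ 2 * w (j - l : ℤ).natAbs = ∑ j ∈ Finset.range (k + 1), ∑ l ∈ Finset.range (k + 1),
      a j ^ 2 * w (j - l : ℤ).natAbs := by
    rw [Finset.sum_comm]
    refine Finset.sum_congr rfl fun j _ => Finset.sum_congr rfl fun l _ => ?_
    rw [← Int.natAbs_neg, neg_sub]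
  have h3 : ∑ j ∈ Finset.range (k + 1), ∑ l ∈ Finset.range (k + 1),
      a j * a l * w (j - l : ℤ).natAbs ≤
      (∑ j ∈ Finset.range (k + 1), ∑ l ∈ Finset.range (k + 1), a j ^ 2 * w (j - l : ℤ).natAbs +
      ∑ j ∈ Finset.range (k + 1), ∑ l ∈ Finset.range (k + 1),
        a l ^ 2 * w (j - l : ℤ).natAbs) / 2 := by
    rw [← Finset.sum_add_distrib, Finset.sum_div]
    refine Finset.sum_le_sum fun j _ => ?_
    rw [← Finset.sum_add_distrib, Finset.sum_div]
    refine Finset.sum_le_sum fun l _ => ?_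
    nlinarith [mul_nonneg (hw (j - l : ℤ).natAbs) (sq_nonneg (a j - a l))]
  linarith

lemma integrable_of_continuousOn_Icc (μ : Measure ℝ) [IsProbabilityMeasure μ]
    (hμ : ∀ᵐ x ∂μ, x ∈ Set.Icc (-1 : ℝ) 1) (f : ℝ → ℝ)
    (hf : ContinuousOn f (Set.Icc (-1 : ℝ) 1)) : Integrable f μ := by
  have h : IntegrableOn f (Set.Icc (-1 : ℝ) 1) μ := hf.integrableOn_compact isCompact_Icc
  rwa [IntegrableOn, Measure.restrict_eq_self_of_ae_mem hμ] at h

lemma continuous_korovkinApprox (f : ℝ → ℝ) (k N : ℕ) : Continuous (korovkinApprox f k N) := by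
  unfold korovkinApprox
  fun_prop

lemma integral_korovkinApprox (μ : Measure ℝ) [IsProbabilityMeasure μ]
    (hμ : ∀ᵐ x ∂μ, x ∈ Set.Icc (-1 : ℝ) 1) (f : ℝ → ℝ) (k N : ℕ) :
    ∫ x, korovkinApprox f k N x ∂μ = (∑ j ∈ Finset.range (k + 1), ∑ l ∈ Finset.range (k + 1),
      korovkinCoeff k j * korovkinCoeff k l * gridCoeff f N (j - l : ℤ) *
        ∫ x, (Chebyshev.T ℝ (j - l : ℤ)).eval x ∂μ) / korovkinMass k := by
  have hT : ∀ n : ℤ, Integrable (fun x => (Chebyshev.T ℝ n).eval x) μ := fun n =>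
    integrable_of_continuousOn_Icc μ hμ _ (Polynomial.continuous _).continuousOn
  simp only [korovkinApprox]
  rw [integral_div, integral_finsetSum]
  · congr 1
    refine Finset.sum_congr rfl fun j _ => ?_
    rw [integral_finsetSum]
    · exact Finset.sum_congr rfl fun l _ => integral_const_mul _ _
    · exact fun l _ => (hT _).const_mul _
  · exact fun j _ => integrable_finsetSum _ fun l _ => (hT _).const_mul _

lemma abs_integral_sub_korovkinApprox_le (μ : Measure ℝ) [IsProbabilityMeasure μ]
    (hμ : ∀ᵐ x ∂μ, x ∈ Set.Icc (-1 : ℝ) 1) (f : ℝ → ℝ)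
    (hf : ∀ x ∈ Set.Icc (-1 : ℝ) 1, ∀ y ∈ Set.Icc (-1 : ℝ) 1, |f x - f y| ≤ |x - y|)
    (k N : ℕ) (hN : k + 1 < N) :
    |∫ x, f x ∂μ - ∫ x, korovkinApprox f k N x ∂μ| ≤ Real.pi / (k + 2) := by
  have hfc : ContinuousOn f (Set.Icc (-1 : ℝ) 1) :=
    (LipschitzOnWith.of_dist_le_mul (K := 1) fun x hx y hy => by
      simpa [Real.dist_eq] using hf x hx y hy).continuousOn
  rw [← integral_sub (integrable_of_continuousOn_Icc μ hμ f hfc)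
    (integrable_of_continuousOn_Icc μ hμ _ (continuous_korovkinApprox f k N).continuousOn),
    ← Real.norm_eq_abs]
  have := norm_integral_le_of_norm_le_const (μ := μ) (C := Real.pi / (k + 2))
    (f := fun x => f x - korovkinApprox f k N x)
    (hμ.mono fun x hx => abs_sub_korovkinApprox_le f hf k N hN x hx)
  simpa using this

lemma integral_sub_le_chebyshev_moments
    (μ ν : Measure ℝ) [IsProbabilityMeasure μ] [IsProbabilityMeasure ν]
    (hμ : ∀ᵐ x ∂μ, x ∈ Set.Icc (-1 : ℝ) 1) (hν : ∀ᵐ x ∂ν, x ∈ Set.Icc (-1 : ℝ) 1)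
    (k : ℕ) (hk : 1 ≤ k) (f : ℝ → ℝ)
    (hf : ∀ x ∈ Set.Icc (-1 : ℝ) 1, ∀ y ∈ Set.Icc (-1 : ℝ) 1, |f x - f y| ≤ |x - y|) :
    (∫ x, f x ∂ν) - (∫ x, f x ∂μ) ≤
      12 / k + ∑ r ∈ Finset.Icc 1 k, (2 / (r : ℝ)) *
        |(∫ x, (Chebyshev.T ℝ (r : ℤ)).eval x ∂ν) -
          (∫ x, (Chebyshev.T ℝ (r : ℤ)).eval x ∂μ)| := by
  set N : ℕ := 2 * (k + 2).factorial with hNdef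
  have hNk : 2 * k + 4 ≤ N := by
    have := Nat.self_le_factorial (k + 2)
    omega
  set D : ℤ → ℝ := fun r => (∫ x, (Chebyshev.T ℝ r).eval x ∂ν) -
    (∫ x, (Chebyshev.T ℝ r).eval x ∂μ) with hD
  have hDabs : ∀ r : ℤ, D ((r.natAbs : ℕ) : ℤ) = D r := by
    intro r
    rw [Int.natCast_natAbs]
    rcases abs_choice r with h | h <;> rw [h]
    simp only [hD, Chebyshev.T_neg]
  have hD0 : D 0 = 0 := by simp [hD]
  set w : ℕ → ℝ := fun r => 1 / (r : ℝ) * |D r| with hw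
  have hcoeff : ∀ r : ℤ, |r| ≤ k → gridCoeff f N r * D r ≤ w r.natAbs := by
    intro r hr
    rcases eq_or_ne r 0 with rfl | h0
    · simp [hw, hD0]
    have hpos : 1 ≤ r.natAbs := Int.natAbs_pos.mpr h0
    have hle : r.natAbs ≤ k := by rw [Int.abs_eq_natAbs] at hr; omega
    obtain ⟨q, hq⟩ := Nat.dvd_factorial hpos (hle.trans (Nat.le_add_right k 2))
    have hG := abs_gridCoeff_le f hf N r.natAbs q hpos (by rw [hNdef, hq]; ring) (by omega)
    rw [Int.natCast_natAbs, gridCoeff_abs] at hG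
    simp only [hw]
    rw [hDabs]
    refine (le_abs_self _).trans ?_
    rw [abs_mul]
    exact mul_le_mul_of_nonneg_right hG (abs_nonneg _)
  have hpoly : (∫ x, korovkinApprox f k N x ∂ν) - (∫ x, korovkinApprox f k N x ∂μ) ≤
      2 * ∑ r ∈ Finset.Icc 1 k, w r := by
    rw [integral_korovkinApprox ν hν, integral_korovkinApprox μ hμ, ← sub_div,
      div_le_iff₀ (korovkinMass_pos k), mul_comm _ (korovkinMass k), ← Finset.sum_sub_distrib]
    refine le_trans (Finset.sum_le_sum fun j hj => ?_)
      (sum_mul_mul_natAbs_sub_le (korovkinCoeff k) w (fun r => by simp only [hw]; positivity)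
        (by simp [hw]) k)
    rw [← Finset.sum_sub_distrib]
    refine Finset.sum_le_sum fun l hl => ?_
    have hj := Finset.mem_range.mp hj
    have hl := Finset.mem_range.mp hl
    have h1 := hcoeff (j - l) (by rw [abs_le]; omega)
    have h2 := mul_le_mul_of_nonneg_left h1
      (mul_pos (korovkinCoeff_pos k j hj) (korovkinCoeff_pos k l hl)).le
    refine le_trans (le_of_eq ?_) h2
    simp only [hD]; ring
  have hsum : 2 * ∑ r ∈ Finset.Icc 1 k, w r = ∑ r ∈ Finset.Icc 1 k, (2 / (r : ℝ)) * |D r| := by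
    rw [Finset.mul_sum]
    refine Finset.sum_congr rfl fun r _ => ?_
    simp only [hw]; ring
  have hε : 2 * (Real.pi / (k + 2)) ≤ 12 / k := by
    have hk0 : (0 : ℝ) < k := by exact_mod_cast hk
    rw [← mul_div_assoc]
    gcongr
    · linarith [Real.pi_le_four]
    · linarith
  have h1 := abs_le.mp (abs_integral_sub_korovkinApprox_le ν hν f hf k N (by omega))
  have h2 := abs_le.mp (abs_integral_sub_korovkinApprox_le μ hμ f hf k N (by omega))
  rw [hsum] at hpoly
  linarith [h1.2, h2.1]

/-- For Borel probability measures `μ, ν` on `[-1,1]` and any `k ≥ 1`,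
the discrepancy of any 1-Lipschitz test function is controlled by `12/k` plus the
weighted discrepancies of the Chebyshev moments; consequently the same bound holds for
the Wasserstein-1 distance between `ν` and `μ`. -/
theorem wasserstein_bound_by_chebyshev_moments
    (μ ν : Measure ℝ) [IsProbabilityMeasure μ] [IsProbabilityMeasure ν]
    (hμ : μ (Set.Icc (-1 : ℝ) 1) = 1) (hν : ν (Set.Icc (-1 : ℝ) 1) = 1)
    (k : ℕ) (hk : 1 ≤ k) :
    (∀ f : ℝ → ℝ,
        (∀ x ∈ Set.Icc (-1 : ℝ) 1, ∀ y ∈ Set.Icc (-1 : ℝ) 1, |f x - f y| ≤ |x - y|) →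
        (∫ x, f x ∂ν) - (∫ x, f x ∂μ) ≤
          12 / k + ∑ r ∈ Finset.Icc 1 k, (2 / (r : ℝ)) *
            |(∫ x, (Polynomial.Chebyshev.T ℝ (r : ℤ)).eval x ∂ν) -
              (∫ x, (Polynomial.Chebyshev.T ℝ (r : ℤ)).eval x ∂μ)|) ∧
      sSup {d : ℝ | ∃ f : ℝ → ℝ,
          (∀ x ∈ Set.Icc (-1 : ℝ) 1, ∀ y ∈ Set.Icc (-1 : ℝ) 1, |f x - f y| ≤ |x - y|) ∧
          d = (∫ x, f x ∂ν) - (∫ x, f x ∂μ)} ≤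
        12 / k + ∑ r ∈ Finset.Icc 1 k, (2 / (r : ℝ)) *
          |(∫ x, (Polynomial.Chebyshev.T ℝ (r : ℤ)).eval x ∂ν) -
            (∫ x, (Polynomial.Chebyshev.T ℝ (r : ℤ)).eval x ∂μ)| := by
  have hμ' : ∀ᵐ x ∂μ, x ∈ Set.Icc (-1 : ℝ) 1 := (prob_compl_eq_zero_iff measurableSet_Icc).mpr hμ
  have hν' : ∀ᵐ x ∂ν, x ∈ Set.Icc (-1 : ℝ) 1 := (prob_compl_eq_zero_iff measurableSet_Icc).mpr hν
  have h := integral_sub_le_chebyshev_moments μ ν hμ' hν' k hk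
  refine ⟨h, Real.sSup_le ?_ (by positivity)⟩
  rintro d ⟨f, hf, rfl⟩
  exact h f hf
end

section
/- For all real numbers A ≥ e and B > 0, the integral ∫_0^∞ min(1, A·exp(−B t²)) dt is at most (1 + √(log A))/√B. -/
open MeasureTheory

/-- Beyond the point `s` with `A = exp (B s²)`, a Gaussian tail is bounded by an exponential of
any rate `c ≤ B s`. -/
theorem mul_exp_neg_mul_sq_le_exp_sub {A B c s t : ℝ} (hB : 0 ≤ B) (hs : 0 ≤ s)
    (hA : A = Real.exp (B * s ^ 2)) (hc : c ≤ B * s) (hst : s ≤ t) :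
    A * Real.exp (-(B * t ^ 2)) ≤ Real.exp (c * s) * Real.exp (-c * t) := by
  rw [hA, ← Real.exp_add, ← Real.exp_add]
  apply Real.exp_le_exp.mpr
  have h1 : c * (t - s) ≤ B * s * (t - s) := mul_le_mul_of_nonneg_right hc (by linarith)
  have h2 : 0 ≤ B * t * (t - s) :=
    mul_nonneg (mul_nonneg hB (hs.trans hst)) (by linarith)
  nlinarith

/-- For `A ≥ e` and `B > 0`,
`∫_0^∞ min(1, A e^{-B t²}) dt ≤ (1 + √(log A)) / √B`. -/
theorem integral_min_one_gaussian_tail_bound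
    (A B : ℝ) (hA : Real.exp 1 ≤ A) (hB : 0 < B) :
    (∫ t in Set.Ioi (0 : ℝ), min 1 (A * Real.exp (-(B * t ^ 2)))) ≤
      (1 + Real.sqrt (Real.log A)) / Real.sqrt B := by
  have hA0 : 0 < A := (Real.exp_pos 1).trans_le hA
  have hlog : 1 ≤ Real.log A := (Real.le_log_iff_exp_le hA0).mpr hA
  have hc : 0 < √B := Real.sqrt_pos.mpr hB
  have hBsq : √B ^ 2 = B := Real.sq_sqrt hB.le
  set s : ℝ := √(Real.log A) / √B with hs_def
  have hs : 0 ≤ s := by positivity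
  have hcs : √B * s = √(Real.log A) := by rw [hs_def]; field_simp
  have hAs : A = Real.exp (B * s ^ 2) := by
    rw [← hBsq, ← mul_pow, hcs, Real.sq_sqrt (by linarith), Real.exp_log hA0]
  have hrate : √B ≤ B * s := by
    have h1 : 1 ≤ √B * s := hcs ▸ Real.one_le_sqrt.mpr hlog
    calc √B ≤ √B * (√B * s) := le_mul_of_one_le_right hc.le h1
      _ = B * s := by rw [← mul_assoc, ← sq, hBsq]
  have hint : Integrable fun t : ℝ => min 1 (A * Real.exp (-(B * t ^ 2))) := by
    refine ((integrable_exp_neg_mul_sq hB).const_mul A).mono'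
      (Continuous.aestronglyMeasurable (by fun_prop)) (.of_forall fun t => ?_)
    rw [Real.norm_of_nonneg (by positivity), neg_mul]
    exact min_le_right _ _
  have hhead : ∫ t in Set.Ioc 0 s, min 1 (A * Real.exp (-(B * t ^ 2))) ≤ s := by
    calc _ ≤ ∫ _ in Set.Ioc 0 s, (1 : ℝ) :=
          integral_mono hint.integrableOn (integrable_const 1) fun _ => min_le_left _ _
      _ = s := by simp [hs]
  have htail : ∫ t in Set.Ioi s, min 1 (A * Real.exp (-(B * t ^ 2))) ≤ 1 / √B := by
    calc _ ≤ ∫ t in Set.Ioi s, Real.exp (√B * s) * Real.exp (-√B * t) :=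
          setIntegral_mono_on hint.integrableOn
            ((integrableOn_exp_mul_Ioi (neg_lt_zero.mpr hc) s).const_mul _) measurableSet_Ioi
            fun t ht => (min_le_right _ _).trans
              (mul_exp_neg_mul_sq_le_exp_sub hB.le hs hAs hrate (le_of_lt ht))
      _ = 1 / √B := by
          rw [integral_const_mul, integral_exp_mul_Ioi (neg_lt_zero.mpr hc), neg_div_neg_eq,
            ← mul_div_assoc, ← Real.exp_add]
          simp
  rw [← Set.Ioc_union_Ioi_eq_Ioi hs, setIntegral_union (Set.Ioc_disjoint_Ioi le_rfl)
    measurableSet_Ioi hint.integrableOn hint.integrableOn, add_div]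
  linarith
end
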